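/- Let m be an even positive integer, π a pair partition of [m] with π(1) = 2, and σ₁,…,σ_m permutations of [N]×[N] with σ₁ = t∘σ₂∘t. If m = 2 then C_N(π,(σ₁,σ₂)) = N², i.e. V_N(π,(σ₁,σ₂)) = 1. If m > 2 then C_N(π,σ⃗) = N · C_N(π′,σ⃗′), equivalently V_N(π,σ⃗) = V_N(π′,σ⃗′), where π′ is the pair partition of [m−2] obtained by removing the block {1,2} (i.e. π′(k) = π(k+2) − 2 for k ∈ [m−2]) and σ⃗′ = (σ₃,σ₄,…,σ_m). -/

import Mathlib

open Filter Topology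

/-- The swap (transpose) map `t(a,b) = (b,a)` on pairs. -/
def swapPair {α : Type*} : α × α → α × α := fun p => (p.2, p.1)

/-- The conjugation `t ∘ μ ∘ t` of a permutation of pairs by the swap `t`. -/
def conjT {α : Type*} (μ : Equiv.Perm (α × α)) : Equiv.Perm (α × α) :=
  (Equiv.prodComm α α).trans (μ.trans (Equiv.prodComm α α))

/-- `C_N(π, σ⃗)`: the number of tuples `(i₁, …, i_m) ∈ [N]^m` (here `i : Fin m → α`)
such that `σ_k(i_k, i_{k+1}) = t(σ_{π(k)}(i_{π(k)}, i_{π(k)+1}))` for all `k`,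
indices read cyclically. -/
noncomputable def pairCount {α : Type*} (m : ℕ) (π : Equiv.Perm (Fin m))
    (σ : Fin m → Equiv.Perm (α × α)) : ℕ :=
  Nat.card {i : Fin m → α // ∀ k : Fin m,
    σ k (i k, i (finRotate m k)) = swapPair ((σ (π k)) (i (π k), i (finRotate m (π k))))}

/-- `V_N(π, σ⃗) = N^{-m/2-1} C_N(π, σ⃗)`. -/
noncomputable def Vval (m N : ℕ) (π : Equiv.Perm (Fin m))
    (σ : Fin m → Equiv.Perm (Fin N × Fin N)) : ℝ :=
  (pairCount m π σ : ℝ) / (N : ℝ) ^ (m / 2 + 1)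

/-- `𝔧(σ : τ) = #{(i,j,k) : σ(i,j) = (t∘τ∘t)(k,j)}`. -/
noncomputable def jcount {α : Type*} (σ τ : Equiv.Perm (α × α)) : ℕ :=
  Nat.card {x : α × α × α // σ (x.1, x.2.1) = (conjT τ) (x.2.2, x.2.1)}

/-- The count in condition (ii) of the main theorem:
`#{(i,j,k) : σ(i,j) ∈ {μ(i,k), μ(k,j), (t∘μ∘t)(i,k), (t∘μ∘t)(k,j)}}`. -/
noncomputable def mixCount {α : Type*} (σ μ : Equiv.Perm (α × α)) : ℕ :=
  Nat.card {x : α × α × α //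
    σ (x.1, x.2.1) = μ (x.1, x.2.2) ∨ σ (x.1, x.2.1) = μ (x.2.2, x.2.1) ∨
    σ (x.1, x.2.1) = conjT μ (x.1, x.2.2) ∨ σ (x.1, x.2.1) = conjT μ (x.2.2, x.2.1)}

/-- `𝔠(φ, ψ) = #{i : φ(i) = ψ(i)}`. -/
noncomputable def fixCount {α : Type*} (φ ψ : Equiv.Perm α) : ℕ := Nat.card {i : α // φ i = ψ i}

theorem conjT_apply_swap {α : Type*} (μ : Equiv.Perm (α × α)) (a b : α) :
    conjT μ (a, b) = swapPair (μ (b, a)) := rfl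

theorem swapPair_swapPair {α : Type*} (p : α × α) : swapPair (swapPair p) = p := rfl

theorem swapPair_injective {α : Type*} :
    Function.Injective (swapPair : α × α → α × α) :=
  Function.LeftInverse.injective swapPair_swapPair

/-- If `i 0 = i 2`, dropping the first two entries of the cyclic word `i` preserves the
successor of each remaining entry. -/
theorem apply_finRotate_succ_succ {α : Type*} {n : ℕ} (i : Fin (n + 3) → α)
    (h : i 0 = i 2) (k : Fin (n + 1)) :
    i (finRotate (n + 3) k.succ.succ) = i (finRotate (n + 1) k).succ.succ := by
  induction k using Fin.lastCases with
  | last =>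
    rw [Fin.succ_last, Fin.succ_last, finRotate_last, finRotate_last]
    exact h
  | cast k =>
    rw [finRotate_apply, finRotate_apply, Fin.coeSucc_eq_succ,
      Fin.succ_castSucc, Fin.succ_castSucc, Fin.coeSucc_eq_succ]

/-- The cyclic pairing conditions split off the block `{0, 1}`, which forces `i 0 = i 2`. -/
theorem pairing_condition_iff {α : Type*} {n : ℕ} (π : Equiv.Perm (Fin (n + 3)))
    (h0 : π 0 = 1) (h1 : π 1 = 0) (σ : Fin (n + 3) → Equiv.Perm (α × α))
    (hσ : σ 0 = conjT (σ 1)) (π' : Equiv.Perm (Fin (n + 1)))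
    (hπ' : ∀ k : Fin (n + 1), π k.succ.succ = (π' k).succ.succ) (i : Fin (n + 3) → α) :
    (∀ k, σ k (i k, i (finRotate _ k)) =
        swapPair (σ (π k) (i (π k), i (finRotate _ (π k))))) ↔
      i 0 = i 2 ∧ ∀ k : Fin (n + 1),
        σ k.succ.succ (i k.succ.succ, i (finRotate _ k).succ.succ) =
          swapPair (σ (π' k).succ.succ
            (i (π' k).succ.succ, i (finRotate _ (π' k)).succ.succ)) := by
  have r0 : finRotate (n + 3) 0 = 1 := by rw [finRotate_apply, zero_add]
  have r1 : finRotate (n + 3) 1 = 2 := by rw [finRotate_apply]; rfl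
  rw [Fin.forall_fin_succ, Fin.forall_fin_succ, Fin.succ_zero_eq_one, h0, h1, r0, r1, hσ,
    conjT_apply_swap, swapPair_swapPair, swapPair_injective.eq_iff,
    (σ 1).injective.eq_iff, (σ 1).injective.eq_iff]
  simp only [Prod.mk.injEq, true_and, hπ']
  constructor
  · rintro ⟨h, -, hk⟩
    simpa only [apply_finRotate_succ_succ i h] using And.intro h hk
  · rintro ⟨h, hk⟩
    simpa only [apply_finRotate_succ_succ i h] using And.intro h (And.intro h.symm hk)

/-- Removing the block `{0, 1}` from the pairing costs a factor `#α`, the free choice of `i 1`. -/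
theorem pairCount_add_three {α : Type*} {n : ℕ} (π : Equiv.Perm (Fin (n + 3)))
    (h0 : π 0 = 1) (h1 : π 1 = 0) (σ : Fin (n + 3) → Equiv.Perm (α × α))
    (hσ : σ 0 = conjT (σ 1)) (π' : Equiv.Perm (Fin (n + 1)))
    (hπ' : ∀ k : Fin (n + 1), π k.succ.succ = (π' k).succ.succ) :
    pairCount (n + 3) π σ =
      Nat.card α * pairCount (n + 1) π' (fun k => σ k.succ.succ) := by
  have key := pairing_condition_iff π h0 h1 σ hσ π' hπ'
  rw [pairCount, pairCount, ← Nat.card_prod]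
  refine Nat.card_congr
    { toFun := fun i => (i.1 1, ⟨fun k => i.1 k.succ.succ, ((key i.1).1 i.2).2⟩)
      invFun := fun p => ⟨Fin.cons (p.2.1 0) (Fin.cons p.1 p.2.1),
        (key _).2 ⟨rfl, p.2.2⟩⟩
      left_inv := fun i => Subtype.ext (funext fun k => ?_)
      right_inv := fun _ => rfl }
  refine Fin.cases ?_ (Fin.cases rfl fun _ => rfl) k
  exact ((key i.1).1 i.2).1.symm

/-- The pairing conditions for the single block `{0, 1}` always hold. -/
theorem pairCount_two {α : Type*} (π : Equiv.Perm (Fin 2)) (h0 : π 0 = 1) (h1 : π 1 = 0)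
    (σ : Fin 2 → Equiv.Perm (α × α)) (hσ : σ 0 = conjT (σ 1)) :
    pairCount 2 π σ = Nat.card α ^ 2 := by
  have key (i : Fin 2 → α) (k : Fin 2) : σ k (i k, i (finRotate 2 k)) =
      swapPair (σ (π k) (i (π k), i (finRotate 2 (π k)))) := by
    have r0 : finRotate 2 0 = 1 := by decide
    have r1 : finRotate 2 1 = 0 := by decide
    fin_cases k
    · simp only [Fin.zero_eta, h0, r0, r1, hσ, conjT_apply_swap]
    · simp only [Fin.mk_one, h1, r0, r1, hσ, conjT_apply_swap, swapPair_swapPair]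
  rw [pairCount, Nat.card_congr (Equiv.subtypeUnivEquiv key), Nat.card_fun, Nat.card_fin]

/-- let `π` be a pair partition of `[m]` with `π(1) = 2` (in 0-based
indexing, `π 0 = 1`) and `σ₁ = t∘σ₂∘t`. If `m = 2` then `C_N = N²` and `V_N = 1`;
if `m > 2` then `C_N(π,σ⃗) = N · C_N(π',σ⃗')` and `V_N(π,σ⃗) = V_N(π',σ⃗')`, where
`π'` is obtained by removing the block `{1,2}` (so `π'(k) + 2 = π(k+2)`) and
`σ⃗' = (σ₃, …, σ_m)`. -/
theorem pairCount_remove_first_block (m : ℕ) (hm : Even m) (hm0 : 0 < m)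
    (π : Equiv.Perm (Fin m)) (hinv : ∀ k, π (π k) = k) (hfix : ∀ k, π k ≠ k)
    (hπ01 : π ⟨0, hm0⟩ = ⟨1, by obtain ⟨r, hr⟩ := hm; omega⟩)
    (N : ℕ) (hN : 0 < N)
    (σ : Fin m → Equiv.Perm (Fin N × Fin N))
    (hσ : σ ⟨0, hm0⟩ = conjT (σ ⟨1, by obtain ⟨r, hr⟩ := hm; omega⟩))
    (π' : Equiv.Perm (Fin (m - 2)))
    (hπ' : ∀ k : Fin (m - 2),
      (π' k : ℕ) + 2 = (π ⟨(k : ℕ) + 2, by have := k.isLt; omega⟩ : ℕ)) :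
    (m = 2 → pairCount m π σ = N ^ 2) ∧
    (m = 2 → Vval m N π σ = 1) ∧
    (2 < m → pairCount m π σ = N * pairCount (m - 2) π'
      (fun k : Fin (m - 2) => σ ⟨(k : ℕ) + 2, by have := k.isLt; omega⟩)) ∧
    (2 < m → Vval m N π σ = Vval (m - 2) N π'
      (fun k : Fin (m - 2) => σ ⟨(k : ℕ) + 2, by have := k.isLt; omega⟩)) := by
  obtain ⟨n, rfl⟩ : ∃ n, m = n + 2 := ⟨m - 2, by obtain ⟨r, hr⟩ := hm; omega⟩
  have h0 : π 0 = 1 := hπ01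
  have h1 : π 1 = 0 := by rw [← h0, hinv]
  have hN' : (N : ℝ) ≠ 0 := Nat.cast_ne_zero.2 hN.ne'
  have two : n + 2 = 2 → pairCount (n + 2) π σ = N ^ 2 := by
    intro hn
    obtain rfl : n = 0 := by omega
    simpa only [Nat.card_fin] using pairCount_two π h0 h1 σ hσ
  have more : 2 < n + 2 → pairCount (n + 2) π σ = N * pairCount (n + 2 - 2) π'
      (fun k : Fin (n + 2 - 2) => σ ⟨(k : ℕ) + 2, by have := k.isLt; omega⟩) := by
    intro hn
    obtain ⟨l, rfl⟩ : ∃ l, n = l + 1 := ⟨n - 1, by omega⟩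
    have h := pairCount_add_three π h0 h1 σ hσ π' fun k => Fin.ext (hπ' k).symm
    rwa [Nat.card_fin] at h
  refine ⟨two, fun hn => ?_, more, fun hn => ?_⟩
  · rw [Vval, two hn, hn, Nat.cast_pow]
    exact div_self (pow_ne_zero 2 hN')
  · have hdiv : (n + 2) / 2 + 1 = ((n + 2 - 2) / 2 + 1) + 1 := by omega
    rw [Vval, Vval, more hn, Nat.cast_mul, hdiv, pow_succ']
    exact mul_div_mul_left _ _ hN'
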